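/- arXiv:1608.01512 — 2 statements merged into one kernel-verified Lean document; each statement's English description precedes it below -/
import Mathlib

section
/- Let G be a commutative cancellative semigroup of uncountable cardinality κ. Then there exists a map d : G → [κ]^{<ω} such that for every uncountable X ⊆ G there exists a set A of ordinals below κ with |A| = |X| such that every finite subset of A equals d(g) for some g ∈ FS(X); that is, d''FS(X) ⊇ [A]^{<ω}. -/
open Cardinal

/-- Sum of `n+1` elements of an additive commutative semigroup. -/
def sgSum {G : Type*} [AddCommSemigroup G] : (n : ℕ) → (Fin (n + 1) → G) → G
  | 0, x => x 0
  | n + 1, x => sgSum n (fun i => x i.castSucc) + x (Fin.last (n + 1))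

/-- `FS(X)`: all sums over nonempty finite subsets of `X`. -/
def FS {G : Type*} [AddCommSemigroup G] (X : Set G) : Set G :=
  {g | ∃ (n : ℕ) (x : Fin (n + 1) → G),
    Function.Injective x ∧ (∀ i, x i ∈ X) ∧ sgSum n x = g}

theorem Module.Baer.finsupp_int {ι K : Type*} [AddCommGroup K] [DivisibleBy K ℤ] :
    Module.Baer ℤ (ι →₀ K) := by
  classical
  let : DivisibleBy (ι →₀ K) ℤ := divisibleByOfSMulRightSurj _ _ fun {n} hn f => by
    refine ⟨f.mapRange (fun x => if x = 0 then 0 else DivisibleBy.div x n) (by simp), ?_⟩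
    ext i
    by_cases h : f i = 0
    · simp [h]
    · simp [h, DivisibleBy.div_cancel _ hn]
  exact Module.Baer.of_divisible _

theorem exists_injective_of_addOrderOf_eq {H K : Type*} [AddCommGroup H] [AddCommGroup K]
    {a : H} {b : K} (h : addOrderOf a = addOrderOf b) :
    ∃ f : Submodule.span ℤ {a} →ₗ[ℤ] K, Function.Injective f := by
  let e := CharacterModule.intSpanEquivQuotAddOrderOf a ≪≫ₗ
    Submodule.quotEquivOfEq _ _ (by rw [h]) ≪≫ₗ
    (CharacterModule.intSpanEquivQuotAddOrderOf b).symm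
  exact ⟨(Submodule.span ℤ {b}).subtype ∘ₗ e.toLinearMap,
    Subtype.val_injective.comp e.injective⟩

theorem exists_iSupIndep_span_singleton_essential (H : Type*) [AddCommGroup H] :
    ∃ s : Set H, iSupIndep (fun a : s => Submodule.span ℤ {(a : H)}) ∧
      ∀ h : H, h ≠ 0 → ∃ n : ℤ, n • h ≠ 0 ∧
        n • h ∈ ⨆ a : s, Submodule.span ℤ {(a : H)} := by
  classical
  let S : Set (Set H) := {s | ∀ t : Finset H, (t : Set H) ⊆ s → ∀ c : H → ℤ,
    ∑ a ∈ t, c a • a = 0 → ∀ a ∈ t, c a • a = 0}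
  obtain ⟨s, hs⟩ := zorn_subset S (by
    intro c hc hchain
    rcases c.eq_empty_or_nonempty with rfl | hne
    · exact ⟨∅, fun t ht _ _ a ha => absurd (ht ha) (by simp), by simp⟩
    refine ⟨⋃₀ c, fun t ht => ?_, fun s hs => Set.subset_sUnion_of_mem hs⟩
    obtain ⟨u, hu, htu⟩ := DirectedOn.exists_mem_subset_of_finset_subset_biUnion
      (f := id) hne (by simpa [DirectedOn] using hchain.directedOn) (s := t)
      (by simpa [Set.sUnion_eq_biUnion] using ht)
    exact hc hu t htu)
  refine ⟨s, ?_, fun h hh => ?_⟩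
  · rw [iSupIndep_iff_finsetSum_eq_zero_imp_eq_zero]
    intro t v hv hsum
    have : ∀ a : s, ∃ n : ℤ, a ∈ t → n • (a : H) = v a := fun a => by
      by_cases ha : a ∈ t
      · obtain ⟨n, hn⟩ := Submodule.mem_span_singleton.1 (hv a ha)
        exact ⟨n, fun _ => hn⟩
      · exact ⟨0, fun h => absurd h ha⟩
    choose n hn using this
    have key := hs.prop (t.map (Function.Embedding.subtype _)) (by simp)
      (fun a => if ha : a ∈ s then n ⟨a, ha⟩ else 0) (by
        rw [Finset.sum_map, ← hsum]
        refine Finset.sum_congr rfl fun a ha => ?_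
        simp [hn a ha])
    intro a ha
    have := key a (by simpa using ha)
    simpa [hn a ha] using this
  · by_cases hmem : h ∈ s
    · exact ⟨1, by simpa, by
        simpa using Submodule.mem_iSup_of_mem (p := fun a : s => Submodule.span ℤ {(a : H)})
          ⟨h, hmem⟩ (Submodule.mem_span_singleton_self h)⟩
    have hnot : insert h s ∉ S := fun hS =>
      hmem (hs.le_of_ge hS (Set.subset_insert _ _) (Set.mem_insert _ _))
    simp only [S, Set.mem_ofPred_eq, not_forall] at hnot
    obtain ⟨t, ht, c, hsum, a, ha, hca⟩ := hnot
    have hts : ((t.erase h : Finset H) : Set H) ⊆ s := by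
      intro x hx
      simp only [Finset.coe_erase, Set.mem_sdiff, Set.mem_singleton_iff] at hx
      exact (ht hx.1).resolve_left hx.2
    have hht : h ∈ t := by
      by_contra hht
      rw [Finset.erase_eq_of_notMem hht] at hts
      exact hca (hs.prop t hts c hsum a ha)
    rw [← Finset.add_sum_erase _ _ hht] at hsum
    have hne : c h • h ≠ 0 := by
      intro h0
      rw [h0, zero_add] at hsum
      by_cases hah : a = h
      · exact hca (hah ▸ h0)
      · exact hca (hs.prop _ hts c hsum a (Finset.mem_erase.2 ⟨hah, ha⟩))
    refine ⟨c h, hne, ?_⟩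
    rw [eq_neg_of_add_eq_zero_left hsum]
    refine Submodule.neg_mem _ (Submodule.sum_mem _ fun x hx => ?_)
    exact Submodule.mem_iSup_of_mem (p := fun a : s => Submodule.span ℤ {(a : H)})
      ⟨x, hts hx⟩ (Submodule.smul_mem _ _ (Submodule.mem_span_singleton_self x))

/-- Every abelian group embeds in a direct sum of copies of a divisible group `K` realising all
orders, indexed by a subset of the group. -/
theorem exists_injective_finsupp (H K : Type*) [AddCommGroup H] [AddCommGroup K]
    [DivisibleBy K ℤ] (hK : ∀ n : ℕ, ∃ b : K, addOrderOf b = n) :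
    ∃ (s : Set H) (f : H →ₗ[ℤ] s →₀ K), Function.Injective f := by
  classical
  obtain ⟨s, hs, hess⟩ := exists_iSupIndep_span_singleton_essential H
  have h1 : ∀ a : s, ∃ f : Submodule.span ℤ {(a : H)} →ₗ[ℤ] K, Function.Injective f := fun a => by
    obtain ⟨b, hb⟩ := hK (addOrderOf (a : H))
    exact exists_injective_of_addOrderOf_eq hb.symm
  choose φ hφ using h1
  let g : (Π₀ a : s, Submodule.span ℤ {(a : H)}) →ₗ[ℤ] s →₀ K :=
    (finsuppLequivDFinsupp ℤ).symm.toLinearMap ∘ₗ DFinsupp.mapRange.linearMap φ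
  have hg : Function.Injective g :=
    (finsuppLequivDFinsupp ℤ).symm.injective.comp
      ((DFinsupp.mapRange_injective _ fun a => map_zero (φ a)).2 hφ)
  obtain ⟨f, hf⟩ := Module.Baer.finsupp_int.extension_property _ hs.dfinsupp_lsum_injective g
  refine ⟨s, f, (injective_iff_map_eq_zero f).2 fun h hh => ?_⟩
  by_contra h0
  obtain ⟨n, hn, hmem⟩ := hess h h0
  rw [Submodule.iSup_eq_range_dfinsupp_lsum] at hmem
  obtain ⟨x, hx⟩ := hmem
  have hgx : g x = 0 := by
    rw [← hf, LinearMap.comp_apply]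
    exact (congrArg f hx).trans (by rw [map_smul, hh, smul_zero])
  rw [(injective_iff_map_eq_zero g).1 hg x hgx] at hx
  exact hn (hx.symm.trans (map_zero _))

instance : Countable (AddCircle (1 : ℚ)) :=
  (QuotientAddGroup.mk_surjective (s := AddSubgroup.zmultiples (1 : ℚ))).countable

theorem exists_addOrderOf_eq (n : ℕ) : ∃ b : ℚ × AddCircle (1 : ℚ), addOrderOf b = n := by
  rcases n.eq_zero_or_pos with rfl | hn
  · refine ⟨(1, 0), addOrderOf_eq_zero_iff'.2 fun m hm h => ?_⟩
    have := congrArg Prod.fst h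
    simp at this
    omega
  · have : Fact ((0 : ℚ) < 1) := ⟨one_pos⟩
    refine ⟨(0, ((1 / n : ℚ) : AddCircle (1 : ℚ))), ?_⟩
    rw [Prod.addOrderOf_mk, AddCircle.addOrderOf_period_div hn]
    simp

theorem exists_injective_addCommGroup {G : Type} [AddCommSemigroup G]
    (hcancel : ∀ a b c : G, a + c = b + c → a = b) (hG : ℵ₀ ≤ #G) :
    ∃ (H : Type) (_ : AddCommGroup H) (f : G → H), Function.Injective f ∧
      (∀ a b, f (a + b) = f a + f b) ∧ #H ≤ #G := by
  let M := WithZero G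
  let ι : M →+ Algebra.GrothendieckAddGroup M := Algebra.GrothendieckAddGroup.of
  refine ⟨Algebra.GrothendieckAddGroup M, inferInstance, fun a => ι (a : M), ?_, ?_, ?_⟩
  · intro a b hab
    obtain ⟨⟨c, _⟩, hc⟩ := (AddSubmonoid.LocalizationMap.eq_iff_exists
      (AddLocalization.addMonoidOf (⊤ : AddSubmonoid M))).1 hab
    revert hc
    refine WithZero.recZeroCoe (motive := fun c : M => c + (a : M) = c + (b : M) → a = b)
      (fun h => WithZero.coe_inj.1 (by simpa only [zero_add] using h))
      (fun c h => hcancel a b c ?_) c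
    rw [add_comm a, add_comm b]
    exact WithZero.coe_inj.1 h
  · intro a b
    simp [WithZero.coe_add]
  · have hM : #M ≤ #G := by
      have : #M = #G + 1 := Cardinal.mk_option
      rw [this, Cardinal.add_one_eq hG]
    have hsurj : Function.Surjective
        fun y : M × (⊤ : AddSubmonoid M) => AddLocalization.mk y.1 y.2 := fun x =>
      AddLocalization.induction_on x fun y => ⟨y, rfl⟩
    calc #(Algebra.GrothendieckAddGroup M) ≤ #(M × (⊤ : AddSubmonoid M)) := mk_le_of_surjective hsurj
      _ = #M * #(⊤ : AddSubmonoid M) := by simp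
      _ ≤ #G * #G := mul_le_mul' hM ((mk_subtype_le _).trans hM)
      _ = #G := mul_eq_self hG

theorem exists_injective_ordinal_finsupp {G : Type} [AddCommSemigroup G]
    (hcancel : ∀ a b c : G, a + c = b + c → a = b) (hG : ℵ₀ ≤ #G) :
    ∃ f : G → Ordinal.{0} →₀ ℚ × AddCircle (1 : ℚ), Function.Injective f ∧
      (∀ a b, f (a + b) = f a + f b) ∧ ∀ g, ∀ α ∈ (f g).support, α < (#G).ord := by
  classical
  obtain ⟨H, _, i, hi, hadd, hcard⟩ := exists_injective_addCommGroup hcancel hG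
  obtain ⟨s, f, hf⟩ := exists_injective_finsupp H _ exists_addOrderOf_eq
  have hle : lift.{1} #s ≤ lift.{0} #(Set.Iio (#G).ord) := by
    rw [mk_Iio_ordinal, card_ord, lift_uzero]
    exact lift_le.2 ((mk_set_le s).trans hcard)
  obtain ⟨e⟩ := lift_mk_le'.1 hle
  have he : Function.Injective fun a => (e a : Ordinal) := Subtype.val_injective.comp e.injective
  refine ⟨fun g => Finsupp.mapDomain (fun a => (e a : Ordinal)) (f (i g)),
    (Finsupp.mapDomain_injective he).comp (hf.comp hi), fun a b => ?_, fun g α hα => ?_⟩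
  · simp only [hadd, map_add, Finsupp.mapDomain_add]
  · obtain ⟨a, -, rfl⟩ := Finset.mem_image.1 (Finsupp.mapDomain_support hα)
    exact (e a).2

universe u

/-- A finite set of positions `u.1 + u.2 * k`, affine in `k`, can be read off from the number
`b + m * k` for arbitrarily large `k`. -/
theorem exists_position_code : ∃ F : ℕ → Finset ℕ, ∀ (b m : ℕ) (U : Finset (ℕ × ℕ)) (B : ℕ),
    0 < m → ∃ k ≥ B, F (b + m * k) = U.image fun u => u.1 + u.2 * k := by
  let F : ℕ → Finset ℕ := fun N =>
    match (Encodable.decode (Nat.unpair (Nat.log 2 N)).2 : Option (ℕ × ℕ × Finset (ℕ × ℕ))) with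
    | none => ∅
    | some c => c.2.2.image fun u => u.1 + u.2 * ((N - c.1) / c.2.1)
  refine ⟨F, fun b m U B hm => ?_⟩
  set i := Nat.pair (b + m * B + m) (Encodable.encode (b, m, U)) with hi
  have hle : b + m * B + m < 2 ^ i := (Nat.left_le_pair _ _).trans_lt Nat.lt_two_pow_self
  have hdiv := Nat.div_add_mod (2 ^ i - b) m
  have hmod := Nat.mod_lt (2 ^ i - b) hm
  set q := (2 ^ i - b) / m
  have hN : b + m * (q + 1) = 2 ^ i + m - (2 ^ i - b) % m := by
    rw [mul_add, mul_one]; omega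
  have hlog : Nat.log 2 (b + m * (q + 1)) = i := by
    rw [Nat.log_eq_iff (Or.inr ⟨by norm_num, by omega⟩), pow_succ]
    omega
  refine ⟨q + 1, ?_, ?_⟩
  · by_contra! hlt
    have := Nat.mul_le_mul_left m hlt.le
    omega
  · simp only [F, hlog, hi, Nat.unpair_pair, Encodable.encodek]
    rw [Nat.add_sub_cancel_left, Nat.mul_div_cancel_left _ hm]

variable {I : Type u} {K : Type} [AddCommGroup K] [Countable K]

theorem mk_supported_le (Z : Set I) :
    #{x : I →₀ K | (x.support : Set I) ⊆ Z} ≤ max #Z ℵ₀ := by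
  have e : {x : I →₀ K | (x.support : Set I) ⊆ Z} ≃ (Z →₀ K) :=
    (Finsupp.supportedEquivFinsupp (M := K) (R := ℤ) Z).toEquiv
  rw [mk_congr e]
  cases finite_or_infinite Z
  · exact (mk_le_aleph0_iff.2 inferInstance).trans (le_max_right _ _)
  cases subsingleton_or_nontrivial K
  · exact (mk_le_aleph0_iff.2 inferInstance).trans (le_max_right _ _)
  rw [mk_finsupp_lift_of_infinite]
  exact max_le_max (by simp) (by simp [mk_le_aleph0])

theorem exists_triangular (X : Set (I →₀ K)) (hX : ℵ₀ < #X) :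
    ∃ (J : Type u) (_ : LinearOrder J) (f : J → I →₀ K) (a : J → I), #J = #X ∧
      (∀ j, f j ∈ X) ∧ (∀ j, f j (a j) ≠ 0) ∧ ∀ i j, i < j → f i (a j) = 0 := by
  classical
  let J := (#X).ord.ToType
  have step : ∀ (j : J) (g : ∀ i : J, i < j → I →₀ K),
      ∃ x ∈ X, ∃ a, x a ≠ 0 ∧ ∀ i h, g i h a = 0 := fun j g => by
    let Z : Set I := ⋃ i : Set.Iio j, (g i.1 i.2).support
    have hZ : #Z ≤ max #(Set.Iio j) ℵ₀ := by
      refine (mk_iUnion_le_sum_mk).trans ((sum_le_mk_mul_iSup _).trans ?_)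
      refine (mul_le_max _ _).trans (max_le (max_le_max le_rfl ?_) (le_max_right _ _))
      exact ciSup_le' fun i => mk_le_aleph0_iff.2 (Finset.countable_toSet _).to_subtype
    have hIio : #(Set.Iio j) < #X := (mk_Iio_lt j (by simp [J])).trans_eq (mk_ord_toType _)
    have hlt : #{x : I →₀ K | (x.support : Set I) ⊆ Z} < #X :=
      (mk_supported_le Z).trans_lt
        (max_lt (hZ.trans_lt (max_lt hIio hX)) hX)
    obtain ⟨x, hx, hxZ⟩ := Set.not_subset.1 fun h : X ⊆ _ => (mk_le_mk_of_subset h).not_gt hlt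
    obtain ⟨a, ha, haZ⟩ := Set.not_subset.1 hxZ
    refine ⟨x, hx, a, by simpa using ha, fun i h => ?_⟩
    by_contra hne
    exact haZ (Set.mem_iUnion.2 ⟨⟨i, h⟩, by simpa using hne⟩)
  choose next hnext a ha hga using step
  let f : J → I →₀ K := WellFounded.fix (wellFounded_lt (α := J)) next
  have hf : ∀ j, f j = next j fun i _ => f i := fun j => WellFounded.fix_eq _ _ _
  refine ⟨J, inferInstance, f, fun j => a j fun i _ => f i, by simp [J], fun j => ?_, fun j => ?_,
    fun i j hij => hga j (fun i _ => f i) i hij⟩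
  · rw [hf]; exact hnext _ _
  · rw [hf]; exact ha _ _

omit [Countable K] in
theorem exists_finset_sum_ne_zero {J : Type*} [LinearOrder J] {f : J → I →₀ K} {a : J → I}
    (hdiag : ∀ j, f j (a j) ≠ 0) (htri : ∀ i j, i < j → f i (a j) = 0) (P : Finset J) :
    ∃ T : Finset (I →₀ K), (∀ t ∈ T, ∃ j ∈ P, f j = t) ∧ ∀ j ∈ P, (∑ t ∈ T, t) (a j) ≠ 0 := by
  classical
  induction P using Finset.induction_on_min with
  | empty => exact ⟨∅, by simp, by simp⟩
  | insert j P hj ih =>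
    obtain ⟨T, hT, hTa⟩ := ih
    by_cases h : (∑ t ∈ T, t) (a j) = 0
    · have hjT : f j ∉ T := fun hmem => by
        obtain ⟨i, hi, hij⟩ := hT _ hmem
        exact hdiag i (hij ▸ htri j i (hj i hi))
      refine ⟨insert (f j) T, ?_, ?_⟩
      · intro t ht
        rcases Finset.mem_insert.1 ht with rfl | ht
        · exact ⟨j, by simp, rfl⟩
        · obtain ⟨i, hi, rfl⟩ := hT t ht
          exact ⟨i, by simp [hi], rfl⟩
      · intro i hi
        rw [Finset.sum_insert hjT, Finsupp.add_apply]
        rcases Finset.mem_insert.1 hi with rfl | hi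
        · simpa [h] using hdiag i
        · simpa [htri j i (hj i hi)] using hTa i hi
    · refine ⟨T, fun t ht => ?_, fun i hi => ?_⟩
      · obtain ⟨i, hi, rfl⟩ := hT t ht
        exact ⟨i, by simp [hi], rfl⟩
      · rcases Finset.mem_insert.1 hi with rfl | hi
        · exact h
        · exact hTa i hi

theorem Set.exists_not_countable_fiber {α β : Type*} [Countable β] {S : Set α}
    (hS : ¬ S.Countable) (f : α → β) : ∃ c, ¬ {x ∈ S | f x = c}.Countable := by
  by_contra! h
  have hsub : S ⊆ ⋃ c, {x ∈ S | f x = c} := fun x hx => Set.mem_iUnion_of_mem (f x) ⟨hx, rfl⟩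
  exact hS ((Set.countable_iUnion h).mono hsub)

/-- A `Δ`-system-like refinement: an uncountable set of finitely supported functions has an
uncountable subset that is constant on a finite root and point-countable off the root. -/
theorem exists_root {X : Set (I →₀ K)} (hX : ¬ X.Countable) :
    ∃ (r : Finset I) (v : I → K) (Y : Set (I →₀ K)), Y ⊆ X ∧ ¬ Y.Countable ∧
      (∀ y ∈ Y, ∀ α ∈ r, y α = v α) ∧ ∀ α ∉ r, {y ∈ Y | y α ≠ 0}.Countable := by
  classical
  obtain ⟨n, hn⟩ := Set.exists_not_countable_fiber hX fun x => x.support.card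
  let Y : Finset I → (I → K) → Set (I →₀ K) := fun r v =>
    {x | (x ∈ X ∧ x.support.card = n) ∧ ∀ α ∈ r, x α = v α ∧ x α ≠ 0}
  let P : ℕ → Prop := fun c => ∃ r v, r.card = c ∧ ¬ (Y r v).Countable
  have hP0 : P 0 := ⟨∅, 0, rfl, by simpa [Y] using hn⟩
  have hPn : ∀ c, P c → c ≤ n := by
    rintro c ⟨r, v, rfl, hY⟩
    obtain ⟨x, hx⟩ : (Y r v).Nonempty :=
      Set.nonempty_iff_ne_empty.2 fun h => hY (h ▸ Set.countable_empty)
    rw [← hx.1.2]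
    exact Finset.card_le_card fun α hα => by simpa using (hx.2 α hα).2
  obtain ⟨r, v, hr, hY⟩ := Nat.findGreatest_spec (P := P) n.zero_le hP0
  refine ⟨r, v, Y r v, fun x hx => hx.1.1, hY, fun y hy α hα => (hy.2 α hα).1, fun α hα => ?_⟩
  by_contra hc
  obtain ⟨c, hc⟩ := Set.exists_not_countable_fiber hc fun y => y α
  have hP : P (r.card + 1) := by
    refine ⟨insert α r, Function.update v α c, Finset.card_insert_of_notMem hα, fun h => hc ?_⟩
    refine h.mono ?_
    intro y hy
    refine ⟨hy.1.1.1, fun β hβ => ?_⟩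
    rcases Finset.mem_insert.1 hβ with rfl | hβ
    · exact ⟨by simpa using hy.2, hy.1.2⟩
    · have : β ≠ α := fun h => hα (h ▸ hβ)
      simpa [this] using hy.1.1.2 β hβ
  have := Nat.le_findGreatest (hPn _ hP) hP
  omega

variable [LinearOrder I]

omit [Countable K] in
theorem exists_pads {Y : Set (I →₀ K)} {r : Finset I} {v : I → K} (hY : ¬ Y.Countable)
    (hr : ∀ y ∈ Y, ∀ α ∈ r, y α = v α) (hout : ∀ α ∉ r, {y ∈ Y | y α ≠ 0}.Countable)
    (p : Finset I) :
    ∃ (m : ℕ) (c : I → ℕ), 0 < m ∧ ∀ (Z : Finset I) (Q : Finset (I →₀ K)) (k : ℕ),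
      ∃ T : Finset (I →₀ K), (T : Set (I →₀ K)) ⊆ Y ∧ T.card = k ∧ Disjoint T Q ∧
        (∀ α ∈ r, (∑ t ∈ T, t) α = k • v α) ∧ Disjoint ((∑ t ∈ T, t).support \ r) Z ∧
        ((∑ t ∈ T, t).support \ r).card = k * m ∧
        ∀ a ∈ p, (((∑ t ∈ T, t).support \ r).filter (· < a)).card = k * c a := by
  classical
  obtain ⟨⟨m, c⟩, hmc⟩ := Set.exists_not_countable_fiber hY fun y =>
    ((y.support \ r).card, fun a : p => ((y.support \ r).filter (· < (a : I))).card)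
  set Y' := {y ∈ Y | ((y.support \ r).card,
    fun a : p => ((y.support \ r).filter (· < (a : I))).card) = (m, c)}
  have hm : ∀ y ∈ Y', (y.support \ r).card = m := fun y hy => congrArg Prod.fst hy.2
  have hc : ∀ y ∈ Y', ∀ a : p, ((y.support \ r).filter (· < (a : I))).card = c a :=
    fun y hy a => congrFun (congrArg Prod.snd hy.2) a
  refine ⟨m, fun a => if ha : a ∈ p then c ⟨a, ha⟩ else 0, ?_, fun Z Q k => ?_⟩
  · by_contra hm0
    refine hmc (Set.Subsingleton.countable fun y hy z hz => ?_)
    have hsupp : ∀ y ∈ Y', ∀ α ∉ r, y α = 0 := fun y hy α hα => by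
      have h0 : y.support \ r = ∅ := Finset.card_eq_zero.1 ((hm y hy).trans (by omega))
      by_contra hne
      exact hα (Finset.sdiff_eq_empty_iff_subset.1 h0 (by simpa using hne))
    ext α
    by_cases hα : α ∈ r
    · rw [hr y hy.1 α hα, hr z hz.1 α hα]
    · rw [hsupp y hy α hα, hsupp z hz α hα]
  · induction k with
    | zero => exact ⟨∅, by simp⟩
    | succ k ih =>
      obtain ⟨T, hTY, hTk, hTQ, hTr, hTZ, hTm, hTc⟩ := ih
      set h := ∑ t ∈ T, t
      let bad : Set (I →₀ K) := ↑(Q ∪ T) ∪ ⋃ α ∈ (Z ∪ h.support) \ r, {y ∈ Y | y α ≠ 0}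
      have hbad : bad.Countable := (Finset.countable_toSet _).union
        ((Finset.countable_toSet _).biUnion fun α hα => hout α (Finset.mem_sdiff.1 hα).2)
      obtain ⟨y, hy, hyb⟩ := Set.not_subset.1 fun hsub : Y' ⊆ bad => hmc (hbad.mono hsub)
      have hyQ : y ∉ Q := fun hq => hyb (Or.inl (by simp [hq]))
      have hyT : y ∉ T := fun hq => hyb (Or.inl (by simp [hq]))
      have hy0 : ∀ α ∉ r, α ∈ Z ∨ h α ≠ 0 → y α = 0 := fun α hα hor => by
        by_contra hne
        refine hyb (Or.inr (Set.mem_biUnion (x := α) ?_ ⟨hy.1, hne⟩))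
        simpa [hα] using hor
      have hsum : ∑ t ∈ insert y T, t = y + h := Finset.sum_insert hyT
      have hdisj : Disjoint (y.support \ r) (h.support \ r) := by
        refine Finset.disjoint_left.2 fun α h1 h2 => ?_
        simp only [Finset.mem_sdiff, Finsupp.mem_support_iff] at h1 h2
        exact h1.1 (hy0 α h1.2 (Or.inr h2.1))
      have hsupp : (y + h).support \ r = (y.support \ r) ∪ (h.support \ r) := by
        ext α
        by_cases hα : α ∈ r
        · simp [hα]
        · by_cases hhα : h α = 0
          · simp [hα, hhα]
          · simp [hα, hhα, hy0 α hα (Or.inr hhα)]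
      refine ⟨insert y T, ?_, ?_, ?_, ?_, ?_, ?_, ?_⟩
      · rw [Finset.coe_insert]
        exact Set.insert_subset hy.1 hTY
      · rw [Finset.card_insert_of_notMem hyT, hTk]
      · exact Finset.disjoint_insert_left.2 ⟨hyQ, hTQ⟩
      · intro α hα
        rw [hsum, Finsupp.add_apply, hr y hy.1 α hα, hTr α hα, succ_nsmul']
      · rw [hsum, hsupp, Finset.disjoint_union_left]
        refine ⟨Finset.disjoint_left.2 fun α h1 h2 => ?_, hTZ⟩
        simp only [Finset.mem_sdiff, Finsupp.mem_support_iff] at h1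
        exact h1.1 (hy0 α h1.2 (Or.inl h2))
      · rw [hsum, hsupp, Finset.card_union_of_disjoint hdisj, hm y hy, hTm]
        ring
      · intro a ha
        rw [hsum, hsupp, Finset.filter_union,
          Finset.card_union_of_disjoint (Finset.disjoint_filter_filter hdisj), hTc a ha,
          hc y hy ⟨a, ha⟩]
        simp only [ha, dite_true]
        ring

omit [Countable K] [LinearOrder I] in
theorem exists_eventually_ne_zero_iff (r : Finset I) (g v : I → K) :
    ∃ (M B : ℕ) (r' : Finset I), 0 < M ∧ r' ⊆ r ∧ (∀ α ∈ r, g α ≠ 0 → α ∈ r') ∧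
      ∀ k ≥ B, ∀ α ∈ r, g α + (M * k) • v α ≠ 0 ↔ α ∈ r' := by
  classical
  let o : I → ℕ := fun α => if addOrderOf (v α) = 0 then 1 else addOrderOf (v α)
  have hM : 0 < ∏ α ∈ r, o α := Finset.prod_pos fun α _ => by
    simp only [o]; split_ifs <;> omega
  set M := ∏ α ∈ r, o α
  let r' := r.filter fun α => addOrderOf (v α) = 0 ∨ g α ≠ 0
  have hev : ∀ α ∈ r, ∀ᶠ k in Filter.atTop, (g α + (M * k) • v α ≠ 0 ↔ α ∈ r') := fun α hα => by
    by_cases h0 : addOrderOf (v α) = 0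
    · have hinj := injective_nsmul_iff_not_isOfFinAddOrder.2 (addOrderOf_eq_zero_iff.1 h0)
      have hfin : {k : ℕ | g α + (M * k) • v α = 0}.Finite :=
        Set.Subsingleton.finite fun k hk l hl =>
          Nat.eq_of_mul_eq_mul_left hM (hinj (add_left_cancel (hk.trans hl.symm)))
      have := hfin.compl_mem_cofinite
      rw [Nat.cofinite_eq_atTop] at this
      filter_upwards [this] with k hk
      exact iff_of_true hk (Finset.mem_filter.2 ⟨hα, Or.inl h0⟩)
    · refine Filter.Eventually.of_forall fun k => ?_
      have ho : o α = addOrderOf (v α) := if_neg h0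
      have hdvd : addOrderOf (v α) ∣ M * k := ho ▸ (Finset.dvd_prod_of_mem o hα).mul_right k
      rw [addOrderOf_dvd_iff_nsmul_eq_zero.1 hdvd, add_zero]
      simp only [r', Finset.mem_filter, hα, h0, true_and, false_or]
  obtain ⟨B, hB⟩ := Filter.eventually_atTop.1 ((Filter.eventually_all_finset r).2 hev)
  exact ⟨M, B, r', hM, Finset.filter_subset _ _, fun α hα hg => by simp [r', hα, hg], hB⟩

theorem Finset.card_filter_lt_injOn (s : Finset I) :
    Set.InjOn (fun a => (s.filter (· < a)).card) s := by
  have hlt : ∀ a ∈ s, ∀ b, a < b → (s.filter (· < a)).card < (s.filter (· < b)).card :=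
    fun a ha b hab => Finset.card_lt_card <| Finset.ssubset_iff_of_subset
      (Finset.monotone_filter_right s fun c _ hc => hc.trans hab) |>.2
      ⟨a, by simp [ha, hab], by simp⟩
  intro a ha b hb hab
  rcases lt_trichotomy a b with h | h | h
  · exact absurd hab (hlt a ha b h).ne
  · exact h
  · exact absurd hab (hlt b hb a h).ne'

variable (I K) in
/-- There is a choice of a subset of the support of each finitely supported function such that,
for every uncountable `X`, the sums of finite subsets of `X` realise all finite subsets of some
set of size `#X`. -/
theorem exists_selector : ∃ D : (I →₀ K) → Finset I, (∀ x, D x ⊆ x.support) ∧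
    ∀ X : Set (I →₀ K), ℵ₀ < #X → ∃ A : Set I, #A = #X ∧ ∀ p : Finset I, (p : Set I) ⊆ A →
      ∃ T : Finset (I →₀ K), T.Nonempty ∧ (T : Set (I →₀ K)) ⊆ X ∧ D (∑ t ∈ T, t) = p := by
  classical
  obtain ⟨F, hF⟩ := exists_position_code
  refine ⟨fun x => x.support.filter fun a =>
    (x.support.filter (· < a)).card ∈ F x.support.card, fun x => Finset.filter_subset _ _,
    fun X hX => ?_⟩
  obtain ⟨J, _, f, a, hJ, hfX, hdiag, htri⟩ := exists_triangular X hX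
  have ha : Function.Injective a := fun i j hij => by
    rcases lt_trichotomy i j with h | h | h
    · exact absurd (hij ▸ htri i j h) (hdiag i)
    · exact h
    · exact absurd (hij ▸ htri j i h) (hdiag j)
  obtain ⟨r, v, Y, hYX, hY, hr, hout⟩ := exists_root (X := X)
    fun h => (le_aleph0_iff_set_countable.2 h).not_gt hX
  refine ⟨Set.range a, (mk_range_eq a ha).trans hJ, fun p hp => ?_⟩
  rw [← Set.image_univ, Finset.subset_set_image_iff] at hp
  obtain ⟨P, -, rfl⟩ := hp
  set p := P.image a
  obtain ⟨T₀, hT₀, hT₀P⟩ := exists_finset_sum_ne_zero hdiag htri P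
  set g := ∑ t ∈ T₀, t
  have hpg : ∀ b ∈ p, g b ≠ 0 := fun b hb => by
    obtain ⟨j, hj, rfl⟩ := Finset.mem_image.1 hb
    exact hT₀P j hj
  obtain ⟨m, c, hm, hpads⟩ := exists_pads hY hr hout p
  obtain ⟨M, B, r', hM, hr'r, hgr', hB⟩ := exists_eventually_ne_zero_iff r g v
  let s := (g.support \ r) ∪ r'
  obtain ⟨k, hk, hFk⟩ := hF s.card (m * M)
    (p.image fun b => ((s.filter (· < b)).card, c b * M)) (B + 1) (Nat.mul_pos hm hM)
  obtain ⟨T, hTY, hTk, hTT, hTr, hTg, hTm, hTc⟩ := hpads g.support T₀ (M * k)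
  set h := ∑ t ∈ T, t
  have hsum : ∑ t ∈ T ∪ T₀, t = g + h := by rw [Finset.sum_union hTT, add_comm]
  have hgh : ∀ α ∉ r, h α ≠ 0 → g α = 0 := fun α hα hne => by
    by_contra hgα
    exact Finset.disjoint_left.1 hTg (Finset.mem_sdiff.2 ⟨by simpa using hne, hα⟩)
      (by simpa using hgα)
  have hsupp : (g + h).support = s ∪ (h.support \ r) := by
    ext α
    by_cases hα : α ∈ r
    · have := hB k (by omega) α hα
      rw [← hTr α hα] at this
      simpa [s, hα] using this
    · have hα' : α ∉ r' := fun h => hα (hr'r h)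
      by_cases hhα : h α = 0
      · simp [s, hα, hα', hhα]
      · simp [s, hα, hα', hhα, hgh α hα hhα]
  have hdisj : Disjoint s (h.support \ r) := by
    refine Finset.disjoint_union_left.2 ⟨?_, ?_⟩
    · exact (hTg.mono_right Finset.sdiff_subset).symm
    · exact Finset.disjoint_sdiff.mono_left hr'r
  have hcard : (g + h).support.card = s.card + m * M * k := by
    rw [hsupp, Finset.card_union_of_disjoint hdisj, hTm]
    ring
  have hpos : ∀ b ∈ p, ((g + h).support.filter (· < b)).card =
      (s.filter (· < b)).card + c b * M * k := fun b hb => by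
    rw [hsupp, Finset.filter_union,
      Finset.card_union_of_disjoint (Finset.disjoint_filter_filter hdisj), hTc b hb]
    ring
  have hps : p ⊆ (g + h).support := fun b hb => by
    rw [hsupp]
    refine Finset.mem_union_left _ ?_
    by_cases hbr : b ∈ r
    · exact Finset.mem_union_right _ (hgr' b hbr (hpg b hb))
    · exact Finset.mem_union_left _ (Finset.mem_sdiff.2 ⟨by simpa using hpg b hb, hbr⟩)
  refine ⟨T ∪ T₀, ?_, ?_, ?_⟩
  · have : 0 < T.card := hTk ▸ Nat.mul_pos hM (by omega)
    exact (Finset.card_pos.1 this).mono Finset.subset_union_left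
  · rw [Finset.coe_union]
    refine Set.union_subset (hTY.trans hYX) fun t ht => ?_
    obtain ⟨j, -, rfl⟩ := hT₀ t ht
    exact hfX j
  · rw [hsum]
    beta_reduce
    rw [hcard, hFk]
    ext b
    simp only [Finset.mem_filter, Finset.mem_image, exists_exists_and_eq_and]
    constructor
    · rintro ⟨hb, b', hb', hbb'⟩
      rw [← hpos b' hb'] at hbb'
      exact Finset.card_filter_lt_injOn _ (hps hb') hb hbb' ▸ hb'
    · exact fun hb => ⟨hps hb, b, hb, (hpos b hb).symm⟩

theorem map_sgSum {G V : Type*} [AddCommSemigroup G] [AddCommMonoid V] {f : G → V}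
    (hf : ∀ a b, f (a + b) = f a + f b) (n : ℕ) (x : Fin (n + 1) → G) :
    f (sgSum n x) = ∑ i, f (x i) := by
  induction n with
  | zero => simp [sgSum]
  | succ n ih => rw [sgSum, hf, ih, Fin.sum_univ_castSucc (n := n + 1)]

theorem exists_mem_FS_map_eq_sum {G V : Type*} [AddCommSemigroup G] [AddCommMonoid V] {f : G → V}
    (hf : ∀ a b, f (a + b) = f a + f b) {X : Set G} {T : Finset V} (hT : T.Nonempty)
    (hTX : (T : Set V) ⊆ f '' X) : ∃ g ∈ FS X, f g = ∑ t ∈ T, t := by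
  obtain ⟨n, hn⟩ := Nat.exists_eq_succ_of_ne_zero hT.card_pos.ne'
  let e := T.equivFinOfCardEq hn
  choose x hx hfx using fun i : Fin (n + 1) => hTX (e.symm i).2
  refine ⟨sgSum n x, ⟨n, x, fun i j hij => ?_, hx, rfl⟩, ?_⟩
  · exact e.symm.injective (Subtype.ext (by rw [← hfx i, ← hfx j, hij]))
  · rw [map_sgSum hf, Finset.sum_congr rfl fun i _ => hfx i, ← Finset.sum_coe_sort T]
    exact e.symm.sum_comp fun t : T => (t : V)

theorem stmt_2 {G : Type} [AddCommSemigroup G]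
    (hcancel : ∀ a b c : G, a + c = b + c → a = b)
    (hG : ℵ₀ < Cardinal.mk G) :
    ∃ d : G → Finset Ordinal.{0},
      (∀ g : G, ∀ α ∈ d g, α < (Cardinal.mk G).ord) ∧
      ∀ X : Set G, ℵ₀ < Cardinal.mk X →
        ∃ A : Set Ordinal.{0}, A ⊆ Set.Iio (Cardinal.mk G).ord ∧
          Cardinal.mk A = Cardinal.lift.{1} (Cardinal.mk X) ∧
          ∀ p : Finset Ordinal.{0}, ↑p ⊆ A → ∃ g ∈ FS X, d g = p := by
  obtain ⟨f, hf, hadd, hsupp⟩ := exists_injective_ordinal_finsupp hcancel hG.le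
  obtain ⟨D, hD, hDX⟩ := exists_selector Ordinal.{0} (ℚ × AddCircle (1 : ℚ))
  have hlt : ∀ g, ∀ α ∈ D (f g), α < (#G).ord := fun g α hα => hsupp g α (hD _ hα)
  refine ⟨fun g => D (f g), hlt, fun X hX => ?_⟩
  have hcard : #(f '' X) = lift.{1} #X := by
    simpa using mk_image_eq_of_injOn_lift f X hf.injOn
  obtain ⟨A, hA, hAp⟩ := hDX (f '' X) (by rw [hcard]; exact aleph0_lt_lift.2 hX)
  have key : ∀ p : Finset Ordinal.{0}, ↑p ⊆ A → ∃ g ∈ FS X, D (f g) = p := fun p hp => by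
    obtain ⟨T, hT, hTX, hDT⟩ := hAp p hp
    obtain ⟨g, hg, hgT⟩ := exists_mem_FS_map_eq_sum hadd hT hTX
    exact ⟨g, hg, hgT ▸ hDT⟩
  refine ⟨A, fun α hα => ?_, hA.trans hcard, key⟩
  obtain ⟨g, -, hg⟩ := key {α} (by simpa using hα)
  exact hlt g α (by simp [hg])
end

section
/- There exists a colouring c : ℝ → ℕ such that for every integer n ≥ 2, every set X ⊆ ℝ of cardinality 𝔠 (the cardinality of the continuum), and every k ∈ ℕ, there exist n pairwise distinct reals x₁, …, xₙ ∈ X with c(x₁ + ⋯ + xₙ) = k. In particular, ℝ ↛ [𝔠]^{FSₙ}_{ℵ₀} holds for every integer n ≥ 2. -/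
open Cardinal

/-- `p` is adherent to `Y` as far as the first `k` coordinates are concerned. -/
def PrefixAdherent (k : ℕ) (p : ℕ → ℝ) (Y : Set (ℕ → ℝ)) : Prop :=
  ∀ ε : ℝ, 0 < ε → ∃ y ∈ Y, ∀ j < k, |y j - p j| < ε

theorem PrefixAdherent.congr {k : ℕ} {p q : ℕ → ℝ} {Y : Set (ℕ → ℝ)}
    (h : PrefixAdherent k p Y) (hpq : ∀ j < k, p j = q j) : PrefixAdherent k q Y := by
  intro ε hε
  obtain ⟨y, hy, hyp⟩ := h ε hε
  exact ⟨y, hy, fun j hj => hpq j hj ▸ hyp j hj⟩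

theorem prefixAdherent_of_mem_closure {p : ℕ → ℝ} {Y : Set (ℕ → ℝ)} (h : p ∈ closure Y)
    (k : ℕ) : PrefixAdherent k p Y := by
  intro ε hε
  have hopen : IsOpen (⋂ j ∈ Finset.range k, {y : ℕ → ℝ | |y j - p j| < ε}) :=
    isOpen_biInter_finset fun j _ => isOpen_lt (by fun_prop) (by fun_prop)
  obtain ⟨y, hyU, hyY⟩ := mem_closure_iff.1 h _ hopen (by simp [hε])
  refine ⟨y, hyY, fun j hj => ?_⟩
  simp only [Set.mem_iInter, Finset.mem_range] at hyU
  exact hyU j hj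

/-- The open half-space `{y | y j < q}` (for `true`) or `{y | q < y j}` (for `false`). -/
def halfSpace (c : ℕ × ℚ × Bool) : Set (ℕ → ℝ) :=
  if c.2.2 then {y | y c.1 < c.2.1} else {y | (c.2.1 : ℝ) < y c.1}

/-- The part of `D` lying in a finite intersection of rational half-spaces. -/
def cell (D : Set (ℕ → ℝ)) (l : List (ℕ × ℚ × Bool)) : Set (ℕ → ℝ) :=
  {y | y ∈ D ∧ ∀ c ∈ l, y ∈ halfSpace c}

theorem PrefixAdherent.cell_lt {k : ℕ} {p : ℕ → ℝ} {D : Set (ℕ → ℝ)}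
    {l : List (ℕ × ℚ × Bool)} {t : ℝ} {q : ℚ}
    (h : PrefixAdherent (k + 1) (Function.update p k t) (cell D l)) (htq : t < q) :
    PrefixAdherent k p (cell D ((k, q, true) :: l)) := by
  intro ε hε
  obtain ⟨y, hy, hyp⟩ := h (min ε (q - t)) (lt_min hε (sub_pos.2 htq))
  refine ⟨y, ⟨hy.1, ?_⟩, fun j hj => ?_⟩
  · intro c hc
    rcases List.mem_cons.1 hc with rfl | hc
    · have h1 := (hyp k (Nat.lt_succ_self k)).trans_le (min_le_right _ _)
      rw [Function.update_self] at h1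
      have h2 : y k < q := by linarith [(abs_lt.1 h1).2]
      simpa [halfSpace] using h2
    · exact hy.2 c hc
  · have h1 := (hyp j (by omega)).trans_le (min_le_left _ _)
    rwa [Function.update_of_ne hj.ne] at h1

theorem PrefixAdherent.cell_gt {k : ℕ} {p : ℕ → ℝ} {D : Set (ℕ → ℝ)}
    {l : List (ℕ × ℚ × Bool)} {t : ℝ} {q : ℚ}
    (h : PrefixAdherent (k + 1) (Function.update p k t) (cell D l)) (hqt : q < t) :
    PrefixAdherent k p (cell D ((k, q, false) :: l)) := by
  intro ε hε
  obtain ⟨y, hy, hyp⟩ := h (min ε (t - q)) (lt_min hε (sub_pos.2 hqt))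
  refine ⟨y, ⟨hy.1, ?_⟩, fun j hj => ?_⟩
  · intro c hc
    rcases List.mem_cons.1 hc with rfl | hc
    · have h1 := (hyp k (Nat.lt_succ_self k)).trans_le (min_le_right _ _)
      rw [Function.update_self] at h1
      have h2 : (q : ℝ) < y k := by linarith [(abs_lt.1 h1).1]
      simpa [halfSpace] using h2
    · exact hy.2 c hc
  · have h1 := (hyp j (by omega)).trans_le (min_le_left _ _)
    rwa [Function.update_of_ne hj.ne] at h1

/-- The values `t` for which `p` with its `k`-th coordinate replaced by `t` is, up to that
coordinate, the only common adherent point of two cells of `D` extending the first `k`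
coordinates of `p`. -/
def isolatedValues (D : Set (ℕ → ℝ)) (k : ℕ) (l l' : List (ℕ × ℚ × Bool)) (p : ℕ → ℝ) :
    Set ℝ :=
  {t | ∀ s, (PrefixAdherent (k + 1) (Function.update p k s) (cell D l) ∧
    PrefixAdherent (k + 1) (Function.update p k s) (cell D l')) ↔ s = t}

theorem isolatedValues_subsingleton (D : Set (ℕ → ℝ)) (k : ℕ) (l l' : List (ℕ × ℚ × Bool))
    (p : ℕ → ℝ) : (isolatedValues D k l l' p).Subsingleton :=
  fun t ht _ hs => (hs t).1 ((ht t).2 rfl)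

theorem isolatedValues_subset_of_eq {D : Set (ℕ → ℝ)} {k : ℕ} {l l' : List (ℕ × ℚ × Bool)}
    {p q : ℕ → ℝ} (h : ∀ j < k, p j = q j) :
    isolatedValues D k l l' p ⊆ isolatedValues D k l l' q := by
  have key : ∀ s, ∀ j < k + 1, Function.update p k s j = Function.update q k s j := by
    intro s j hj
    rcases (Nat.lt_succ_iff_lt_or_eq.1 hj) with hj | rfl
    · rw [Function.update_of_ne hj.ne, Function.update_of_ne hj.ne, h j hj]
    · simp
  intro t ht s
  rw [← ht s]
  exact and_congr ⟨fun h => h.congr fun j hj => (key s j hj).symm, fun h => h.congr (key s)⟩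
    ⟨fun h => h.congr fun j hj => (key s j hj).symm, fun h => h.congr (key s)⟩

/-- No coordinate of `p` is determined by the previous ones together with two cells of `D`. -/
def GenericOver (D : Set (ℕ → ℝ)) (p : ℕ → ℝ) : Prop :=
  ∀ k l l', p k ∉ isolatedValues D k l l' p

theorem GenericOver.exists_update {D : Set (ℕ → ℝ)} {p : ℕ → ℝ} (hp : GenericOver D p) {k : ℕ}
    {l l' : List (ℕ × ℚ × Bool)} (h : PrefixAdherent (k + 1) p (cell D l))
    (h' : PrefixAdherent (k + 1) p (cell D l')) :
    ∃ s t, s < t ∧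
      PrefixAdherent (k + 1) (Function.update p k s) (cell D l) ∧
      PrefixAdherent (k + 1) (Function.update p k s) (cell D l') ∧
      PrefixAdherent (k + 1) (Function.update p k t) (cell D l) ∧
      PrefixAdherent (k + 1) (Function.update p k t) (cell D l') := by
  have h1 := hp k l l'
  simp only [isolatedValues, Set.mem_ofPred_eq, not_forall] at h1
  obtain ⟨s, hs⟩ := h1
  have hne : s ≠ p k := by
    rintro rfl
    simp [Function.update_eq_self, h, h'] at hs
  have hs' : PrefixAdherent (k + 1) (Function.update p k s) (cell D l) ∧
      PrefixAdherent (k + 1) (Function.update p k s) (cell D l') := by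
    by_contra hcon
    exact hs ⟨fun h => absurd h hcon, fun h => absurd h hne⟩
  rcases lt_or_gt_of_ne hne with hlt | hlt
  · exact ⟨s, p k, hlt, hs'.1, hs'.2, by simpa using h, by simpa using h'⟩
  · exact ⟨p k, s, hlt, by simpa using h, by simpa using h', hs'.1, hs'.2⟩

theorem GenericOver.exists_forall_lt {D : Set (ℕ → ℝ)} {p : ℕ → ℝ} (hp : GenericOver D p)
    (k : ℕ) : ∀ l l' : List (ℕ × ℚ × Bool), PrefixAdherent k p (cell D l) →
      PrefixAdherent k p (cell D l') →
      ∃ y ∈ cell D l, ∃ y' ∈ cell D l', ∀ j < k, y j < y' j := by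
  induction k with
  | zero =>
    intro l l' h h'
    obtain ⟨y, hy, -⟩ := h 1 one_pos
    obtain ⟨y', hy', -⟩ := h' 1 one_pos
    exact ⟨y, hy, y', hy', by simp⟩
  | succ k ih =>
    intro l l' h h'
    obtain ⟨s, t, hst, hs, -, -, ht⟩ := hp.exists_update h h'
    obtain ⟨q, hsq, hqt⟩ := exists_rat_btwn hst
    obtain ⟨y, hy, y', hy', hlt⟩ := ih _ _ (hs.cell_lt hsq) (ht.cell_gt hqt)
    refine ⟨y, ⟨hy.1, fun c hc => hy.2 c (List.mem_cons_of_mem _ hc)⟩, y',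
      ⟨hy'.1, fun c hc => hy'.2 c (List.mem_cons_of_mem _ hc)⟩, fun j hj => ?_⟩
    rcases (Nat.lt_succ_iff_lt_or_eq.1 hj) with hj | rfl
    · exact hlt j hj
    · have h1 : y j < q := by simpa [halfSpace] using hy.2 _ List.mem_cons_self
      have h2 : (q : ℝ) < y' j := by simpa [halfSpace] using hy'.2 _ List.mem_cons_self
      exact h1.trans h2

theorem GenericOver.exists_lt_and_gt {D : Set (ℕ → ℝ)} {p : ℕ → ℝ} (hp : GenericOver D p)
    (hpD : p ∈ closure D) (k : ℕ) :
    ∃ y ∈ D, ∃ y' ∈ D, (∀ j < k, y j < y' j) ∧ y' k < y k := by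
  have h : PrefixAdherent (k + 1) p (cell D []) := by
    simpa [cell] using prefixAdherent_of_mem_closure hpD (k + 1)
  obtain ⟨s, t, hst, hs, -, ht, -⟩ := hp.exists_update h h
  obtain ⟨q, hsq, hqt⟩ := exists_rat_btwn hst
  obtain ⟨y, hy, y', hy', hlt⟩ := hp.exists_forall_lt k _ _ (ht.cell_gt hqt) (hs.cell_lt hsq)
  have h1 : (q : ℝ) < y k := by simpa [halfSpace] using hy.2 _ List.mem_cons_self
  have h2 : y' k < q := by simpa [halfSpace] using hy'.2 _ List.mem_cons_self
  exact ⟨y, hy.1, y', hy'.1, hlt, h2.trans h1⟩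

/-- The sequence whose `k`-th term is `F k` applied to its own truncation below `k`. -/
noncomputable def prefixRec (F : ℕ → (ℕ → ℝ) → ℝ) : ℕ → ℝ
  | k => F k fun j => if _h : j < k then prefixRec F j else 0

theorem exists_forall_genericOver {S : Type} (hS : #S < 𝔠) (D : S → Set (ℕ → ℝ)) :
    ∃ p, ∀ s, GenericOver (D s) p := by
  let I := S × ℕ × List (ℕ × ℚ × Bool) × List (ℕ × ℚ × Bool)
  have hI : #I < 𝔠 := by
    have : #I = #S * #(ℕ × List (ℕ × ℚ × Bool) × List (ℕ × ℚ × Bool)) := by simp [I]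
    rw [this]
    exact mul_lt_of_lt aleph0_le_continuum hS (mk_le_aleph0.trans_lt aleph0_lt_continuum)
  have hex : ∀ (k : ℕ) (p : ℕ → ℝ), ∃ t : ℝ, ∀ s l l', t ∉ isolatedValues (D s) k l l' p := by
    intro k p
    by_contra! hcon
    have hcover : (Set.univ : Set ℝ) ⊆
        ⋃ i : I, isolatedValues (D i.1) k i.2.2.1 i.2.2.2 p := by
      intro t _
      obtain ⟨s, l, l', h⟩ := hcon t
      exact Set.mem_iUnion.2 ⟨(s, 0, l, l'), h⟩
    have h1 := (mk_le_mk_of_subset hcover).trans (mk_iUnion_le _)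
    have h2 : (⨆ i : I, #(isolatedValues (D i.1) k i.2.2.1 i.2.2.2 p)) ≤ 1 :=
      ciSup_le' fun i => mk_le_one_iff_set_subsingleton.2 (isolatedValues_subsingleton _ _ _ _ _)
    have h3 := h1.trans (mul_le_mul_right h2 #I)
    rw [mk_univ_real, mul_one] at h3
    exact absurd hI h3.not_gt
  choose F hF using hex
  refine ⟨prefixRec F, fun s k l l' hmem => ?_⟩
  refine hF k (fun j => if j < k then prefixRec F j else 0) s l l' ?_
  have : prefixRec F k = F k (fun j => if j < k then prefixRec F j else 0) := by
    conv_lhs => rw [prefixRec]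
    simp
  rw [← this]
  exact isolatedValues_subset_of_eq (fun j hj => by simp [hj]) hmem

/-- The first coordinate, counted after the zeroth one, in which `y` and `z` compare
differently than in the zeroth one. -/
noncomputable def orderSwitch (y z : ℕ → ℝ) : ℕ :=
  sInf {k | ¬(y (k + 1) < z (k + 1) ↔ y 0 < z 0)}

theorem orderSwitch_eq {y z : ℕ → ℝ} {k : ℕ} (h : ∀ j < k + 1, y j < z j)
    (hk : z (k + 1) < y (k + 1)) : orderSwitch y z = k := by
  have h0 := h 0 (Nat.succ_pos k)
  apply le_antisymm
  · exact Nat.sInf_le (by simp [h0, hk.le])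
  · refine le_csInf ⟨k, by simp [h0, hk.le]⟩ fun j hj => ?_
    by_contra! hlt
    exact hj (by simp [h0, h (j + 1) (by omega)])

theorem orderSwitch_eq_swap {y z : ℕ → ℝ} {k : ℕ} (h : ∀ j < k + 1, y j < z j)
    (hk : z (k + 1) < y (k + 1)) : orderSwitch z y = k := by
  have h0 := (h 0 (Nat.succ_pos k)).le
  apply le_antisymm
  · exact Nat.sInf_le (by simp [h0.not_gt, hk])
  · refine le_csInf ⟨k, by simp [h0.not_gt, hk]⟩ fun j hj => ?_
    by_contra! hlt
    exact hj (by simp [h0.not_gt, (h (j + 1) (by omega)).le])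

/-- A form of the Galvin–Shelah theorem on colourings of pairs of reals: every colour occurs on
every set that is unbounded in `r`. -/
theorem exists_pair_colouring (r : ℝ → ℝ → Prop) (hr : ∀ a, #{x // r x a} < 𝔠) :
    ∃ f : ℝ → ℝ → ℕ, ∀ A : Set ℝ, (∀ a, ∃ b ∈ A, r a b) → ∀ k,
      ∃ a ∈ A, ∃ b ∈ A, a ≠ b ∧ f a b = k ∧ f b a = k := by
  have hcard : #ℝ = #(ℕ → ℕ → ℝ) := by simp [mk_real, continuum_power_aleph0]
  obtain ⟨ψ⟩ := Cardinal.eq.1 hcard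
  choose G hG using fun a => exists_forall_genericOver (hr a) fun x => Set.range (ψ x.1)
  refine ⟨fun a b => orderSwitch (G a) (G b), fun A hA k => ?_⟩
  have hne : (G '' A).Nonempty := let ⟨b, hb, _⟩ := hA 0; ⟨_, b, hb, rfl⟩
  have := hne.to_subtype
  let d : ℕ → ℕ → ℝ := fun n => (TopologicalSpace.denseSeq (G '' A) n : ℕ → ℝ)
  obtain ⟨b, hb, hab⟩ := hA (ψ.symm d)
  have hgen : GenericOver (Set.range d) (G b) := by simpa using hG b ⟨ψ.symm d, hab⟩
  have hcl : G b ∈ closure (Set.range d) := by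
    have h1 : (⟨G b, b, hb, rfl⟩ : G '' A) ∈
        closure (Set.range (TopologicalSpace.denseSeq (G '' A))) :=
      TopologicalSpace.denseRange_denseSeq _ _
    have h2 := image_closure_subset_closure_image continuous_subtype_val
      (Set.mem_image_of_mem Subtype.val h1)
    rwa [← Set.range_comp] at h2
  have hd : ∀ y ∈ Set.range d, ∃ a ∈ A, G a = y := by
    rintro _ ⟨n, rfl⟩
    exact (TopologicalSpace.denseSeq (G '' A) n).2
  obtain ⟨y, hy, z, hz, hlt, hgt⟩ := hgen.exists_lt_and_gt hcl (k + 1)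
  obtain ⟨a, ha, rfl⟩ := hd y hy
  obtain ⟨c, hc, rfl⟩ := hd z hz
  refine ⟨a, ha, c, hc, ?_, orderSwitch_eq hlt hgt, orderSwitch_eq_swap hlt hgt⟩
  rintro rfl
  exact lt_irrefl _ hgt

/-- `m` is the `r`-largest element of `s` and `o` is its strictly nearest neighbour in `s`. -/
def IsTopPair (r : ℝ → ℝ → Prop) (s : Finset ℝ) (m o : ℝ) : Prop :=
  m ∈ s ∧ o ∈ s ∧ o ≠ m ∧ (∀ x ∈ s, x = m ∨ r x m) ∧
    ∀ x ∈ s, x = m ∨ x = o ∨ |m - o| < |m - x|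

theorem IsTopPair.unique {r : ℝ → ℝ → Prop} [IsWellOrder ℝ r] {s : Finset ℝ} {m o m' o' : ℝ}
    (h : IsTopPair r s m o) (h' : IsTopPair r s m' o') : m = m' ∧ o = o' := by
  obtain ⟨hm, ho, hne, hmax, hnear⟩ := h
  obtain ⟨hm', ho', hne', hmax', hnear'⟩ := h'
  have hmm : m = m' := by
    rcases hmax' m hm with h | h
    · exact h
    rcases hmax m' hm' with h' | h'
    · exact h'.symm
    · exact absurd h (asymm h')
  subst hmm
  refine ⟨rfl, ?_⟩
  rcases hnear o' ho' with h | h | h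
  · exact absurd h hne'
  · exact h.symm
  rcases hnear' o ho with h' | h' | h'
  · exact absurd h' hne
  · exact h'
  · exact absurd h h'.not_gt

theorem exists_top_pair_colouring (r : ℝ → ℝ → Prop) [IsWellOrder ℝ r] (f : ℝ → ℝ → ℕ) :
    ∃ g : Finset ℝ → ℕ, ∀ s m o, IsTopPair r s m o → g s = f m o := by
  classical
  refine ⟨fun s => if h : ∃ k, ∃ m o, IsTopPair r s m o ∧ f m o = k then h.choose else 0,
    fun s m o h => ?_⟩
  have hex : ∃ k, ∃ m o, IsTopPair r s m o ∧ f m o = k := ⟨_, m, o, h, rfl⟩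
  obtain ⟨m', o', h', hk⟩ := hex.choose_spec
  obtain ⟨rfl, rfl⟩ := h.unique h'
  simp only [dif_pos hex]
  exact hk.symm

theorem exists_linearMap_injective_finsupp :
    ∃ φ : ℝ →ₗ[ℚ] (ℝ →₀ ℚ), Function.Injective φ := by
  let b := Module.Basis.ofVectorSpace ℚ ℝ
  refine ⟨(Finsupp.lmapDomain ℚ ℚ Subtype.val).comp b.repr.toLinearMap, ?_⟩
  exact (Finsupp.mapDomain_injective Subtype.val_injective).comp b.repr.injective

theorem mk_setOf_support_subset_lt {φ : ℝ → (ℝ →₀ ℚ)} (hφ : Function.Injective φ) {I : Set ℝ}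
    (hI : #I < 𝔠) : #{x : ℝ | ∀ a ∈ (φ x).support, a ∈ I} < 𝔠 := by
  have h1 : #{x : ℝ | ∀ a ∈ (φ x).support, a ∈ I} ≤ #(Finsupp.supported ℚ ℚ I) :=
    mk_le_of_injective (f := fun x => ⟨φ x.1, fun a ha => x.2 a ha⟩) fun x y hxy =>
      Subtype.ext (hφ (congrArg Subtype.val hxy))
  refine h1.trans_lt ?_
  rw [(Finsupp.supportedEquivFinsupp (M := ℚ) (R := ℚ) I).toEquiv.cardinal_eq]
  rcases isEmpty_or_nonempty I with h | h
  · exact (le_one_iff_subsingleton.2 inferInstance).trans_lt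
      (one_lt_aleph0.trans aleph0_lt_continuum)
  · rw [mk_finsupp_of_infinite']
    exact max_lt hI (by simpa using aleph0_lt_continuum)

theorem mk_setOf_eq_or_lt {r : ℝ → ℝ → Prop} (hr : ∀ a, #{x // r x a} < 𝔠) (a : ℝ) :
    #{x | x = a ∨ r x a} < 𝔠 := by
  have h : #{x | x = a ∨ r x a} ≤ #({a} : Set ℝ) + #{x | r x a} := mk_union_le {a} {x | r x a}
  refine h.trans_lt (add_lt_of_lt aleph0_le_continuum ?_ (hr a))
  rw [mk_singleton]
  exact one_lt_aleph0.trans aleph0_lt_continuum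

theorem Finset.exists_eq_or_rel_of_isWellOrder (r : ℝ → ℝ → Prop) [IsWellOrder ℝ r]
    (s : Finset ℝ) (hs : s.Nonempty) : ∃ m ∈ s, ∀ x ∈ s, x = m ∨ r x m := by
  classical
  induction hs using Finset.Nonempty.cons_induction with
  | singleton a => exact ⟨a, by simp⟩
  | cons a s ha hs ih =>
    obtain ⟨m, hm, hmax⟩ := ih
    rcases trichotomous_of r a m with h | h | h
    · refine ⟨m, by simp [hm], fun x hx => ?_⟩
      rcases Finset.mem_cons.1 hx with rfl | hx
      · exact Or.inr h
      · exact hmax x hx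
    · exact absurd (h ▸ hm) ha
    · refine ⟨a, by simp, fun x hx => ?_⟩
      rcases Finset.mem_cons.1 hx with rfl | hx
      · exact Or.inl rfl
      · rcases hmax x hx with rfl | hx
        · exact Or.inr h
        · exact Or.inr (trans_of r hx h)

/-- A rational interval around `t` that is well separated from the rest of a finite set. -/
theorem exists_rat_separating (s : Finset ℝ) (t : ℝ) :
    ∃ w : ℚ × ℚ, |t - w.1| < w.2 ∧ ∀ a ∈ s, a ≠ t → 3 * (w.2 : ℝ) < |a - w.1| := by
  have hδ : ∃ δ : ℝ, 0 < δ ∧ ∀ a ∈ s, a ≠ t → δ ≤ |a - t| := by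
    induction s using Finset.cons_induction with
    | empty => exact ⟨1, one_pos, by simp⟩
    | cons b s hb ih =>
      obtain ⟨δ, hδ, h⟩ := ih
      by_cases hbt : b = t
      · refine ⟨δ, hδ, fun a ha hat => ?_⟩
        rcases Finset.mem_cons.1 ha with rfl | ha
        · exact absurd hbt hat
        · exact h a ha hat
      · refine ⟨min δ |b - t|, lt_min hδ (abs_pos.2 (sub_ne_zero.2 hbt)), fun a ha hat => ?_⟩
        rcases Finset.mem_cons.1 ha with rfl | ha
        · exact min_le_right _ _
        · exact (min_le_left _ _).trans (h a ha hat)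
  obtain ⟨δ, hδ, h⟩ := hδ
  obtain ⟨ε, hε, hεδ⟩ := exists_rat_btwn (show (0 : ℝ) < δ / 4 by positivity)
  obtain ⟨q, hq, hqε⟩ := exists_rat_btwn (show t < t + ε by linarith)
  refine ⟨(q, ε), ?_, fun a ha hat => ?_⟩
  · exact abs_lt.2 ⟨by linarith, by linarith⟩
  · have h1 := h a ha hat
    have h2 : |a - t| ≤ |a - q| + |(q : ℝ) - t| := abs_sub_le _ _ _
    have h3 : |(q : ℝ) - t| < ε := abs_lt.2 ⟨by linarith, by linarith⟩
    simp only
    linarith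

theorem isTopPair_support_add {r : ℝ → ℝ → Prop} [IsWellOrder ℝ r] {u v z : ℝ →₀ ℚ}
    {T : Finset ℝ} {m o q ε : ℝ} (hm : m ∈ u.support) (ho : o ∈ v.support)
    (hzT : z.support ⊆ T) (hmmax : ∀ x ∈ u.support, x = m ∨ r x m)
    (homax : ∀ x ∈ v.support, x = o ∨ r x o) (hTm : ∀ x ∈ T, r x m) (hTo : ∀ x ∈ T, r x o)
    (hom : r o m) (hmq : |m - q| < ε) (hoq : |o - q| < ε)
    (hu : ∀ a ∈ u.support, a ≠ m → 3 * ε < |a - q|)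
    (hv : ∀ a ∈ v.support, a ≠ o → 3 * ε < |a - q|)
    (hT : ∀ a ∈ T, a ≠ m → 3 * ε < |a - q|) :
    IsTopPair r (u + (v + z)).support m o := by
  classical
  have hne : o ≠ m := fun h => irrefl_of r m (h ▸ hom)
  have hε : 0 < ε := (abs_nonneg _).trans_lt hmq
  have hmv : v m = 0 := by
    by_contra hcon
    linarith [hv m (Finsupp.mem_support_iff.2 hcon) hne.symm]
  have hou : u o = 0 := by
    by_contra hcon
    linarith [hu o (Finsupp.mem_support_iff.2 hcon) hne]
  have hmz : z m = 0 := by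
    by_contra hcon
    exact irrefl_of r m (hTm m (hzT (Finsupp.mem_support_iff.2 hcon)))
  have hoz : z o = 0 := by
    by_contra hcon
    exact irrefl_of r o (hTo o (hzT (Finsupp.mem_support_iff.2 hcon)))
  have hsub : ∀ x ∈ (u + (v + z)).support, x ∈ u.support ∨ x ∈ v.support ∨ x ∈ T := by
    intro x hx
    rcases Finset.mem_union.1 (Finsupp.support_add hx) with h | h
    · exact Or.inl h
    · rcases Finset.mem_union.1 (Finsupp.support_add h) with h | h
      · exact Or.inr (Or.inl h)
      · exact Or.inr (Or.inr (hzT h))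
  have hfar : ∀ a, 3 * ε < |a - q| → |m - o| < |m - a| := by
    intro a ha
    have h1 : |m - o| ≤ |m - q| + |q - o| := abs_sub_le _ _ _
    have h2 : |a - q| ≤ |a - m| + |m - q| := abs_sub_le _ _ _
    rw [abs_sub_comm q o] at h1
    rw [abs_sub_comm a m] at h2
    linarith
  refine ⟨?_, ?_, hne, fun x hx => ?_, fun x hx => ?_⟩
  · simpa [hmv, hmz] using hm
  · simpa [hou, hoz] using ho
  · rcases hsub x hx with h | h | h
    · exact hmmax x h
    · rcases homax x h with rfl | h
      · exact Or.inr hom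
      · exact Or.inr (trans_of r h hom)
    · exact Or.inr (hTm x h)
  · by_cases hxm : x = m
    · exact Or.inl hxm
    by_cases hxo : x = o
    · exact Or.inr (Or.inl hxo)
    refine Or.inr (Or.inr (hfar x ?_))
    rcases hsub x hx with h | h | h
    · exact hu x h hxm
    · exact hv x h hxo
    · exact hT x h hxm

theorem stmt_17 :
    ∃ c : ℝ → ℕ,
      ∀ n : ℕ, 2 ≤ n →
        ∀ X : Set ℝ, Cardinal.mk X = Cardinal.continuum →
          ∀ k : ℕ,
            ∃ x : Fin n → ℝ, Function.Injective x ∧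
              (∀ i, x i ∈ X) ∧ c (∑ i, x i) = k := by
  classical
  obtain ⟨r, hwo, hord⟩ := exists_ord_eq ℝ
  have hr : ∀ a, #{x // r x a} < 𝔠 := fun a => by
    simpa [mk_real] using card_typein_lt (r := r) a hord
  obtain ⟨f, hf⟩ := exists_pair_colouring r hr
  obtain ⟨g, hg⟩ := exists_top_pair_colouring r f
  obtain ⟨φ, hφ⟩ := exists_linearMap_injective_finsupp
  refine ⟨fun x => g (φ x).support, fun n hn X hX k => ?_⟩
  obtain ⟨n, rfl⟩ := Nat.exists_eq_add_of_le' hn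
  have hsmall : ∀ a, #{x : ℝ | ∀ b ∈ (φ x).support, b = a ∨ r b a} < 𝔠 := fun a =>
    mk_setOf_support_subset_lt hφ (mk_setOf_eq_or_lt hr a)
  have : Infinite X := infinite_iff.2 (hX ▸ aleph0_le_continuum)
  let z : Fin n → ℝ := fun i => (Infinite.natEmbedding X i : ℝ)
  have hz : Function.Injective z := fun i j hij =>
    Fin.ext ((Infinite.natEmbedding X).injective (Subtype.ext hij))
  let T : Finset ℝ := Finset.univ.biUnion fun i => (φ (z i)).support
  obtain ⟨γ, -, hγ⟩ := Finset.exists_eq_or_rel_of_isWellOrder r (insert 0 T) (by simp)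
  have hsupp : ∀ x, ∃ t, (φ x).support.Nonempty →
      t ∈ (φ x).support ∧ ∀ a ∈ (φ x).support, a = t ∨ r a t := by
    intro x
    by_cases h : (φ x).support.Nonempty
    · obtain ⟨t, ht⟩ := Finset.exists_eq_or_rel_of_isWellOrder r _ h
      exact ⟨t, fun _ => ht⟩
    · exact ⟨0, fun h' => absurd h' h⟩
  choose τ hτ using hsupp
  have le_of_not_rel : ∀ {a b}, ¬r a b → b = a ∨ r b a := by
    intro a b h
    rcases trichotomous_of r a b with h' | h' | h'
    · exact absurd h' h
    · exact Or.inl h'.symm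
    · exact Or.inr h'
  have hmem_small : ∀ {x a}, ¬r a (τ x) → ∀ b ∈ (φ x).support, b = a ∨ r b a := by
    intro x a h b hb
    rcases le_of_not_rel h with h | h <;> rcases (hτ x ⟨b, hb⟩).2 b hb with h' | h'
    · exact Or.inl (h'.trans h)
    · exact Or.inr (h ▸ h')
    · exact Or.inr (h' ▸ h)
    · exact Or.inr (trans_of r h' h)
  let X' : Set ℝ := {x | x ∈ X ∧ (φ x).support.Nonempty ∧ r γ (τ x)}
  have hX' : #X' = 𝔠 := by
    refine le_antisymm ((mk_set_le _).trans_eq mk_real) (le_of_not_gt fun hlt => ?_)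
    have hsub : X ⊆ X' ∪ {x : ℝ | ∀ b ∈ (φ x).support, b = γ ∨ r b γ} := by
      intro x hx
      by_cases h : r γ (τ x)
      · by_cases h' : (φ x).support.Nonempty
        · exact Or.inl ⟨hx, h', h⟩
        · exact Or.inr fun b hb => absurd ⟨b, hb⟩ h'
      · exact Or.inr (hmem_small h)
    have := (mk_le_mk_of_subset hsub).trans (mk_union_le _ _)
    exact absurd (this.trans_lt (add_lt_of_lt aleph0_le_continuum hlt (hsmall γ))) hX.not_lt
  choose W hW hWsep using fun x => exists_rat_separating ((φ x).support ∪ T) (τ x)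
  obtain ⟨w, hw⟩ := infinite_pigeonhole (fun x : X' => W x) (hX' ▸ aleph0_le_continuum) (by
    rw [hX', ← two_power_aleph0]
    exact mk_le_aleph0.trans_lt (lt_cof_ord_power le_rfl one_lt_two))
  let Y : Set ℝ := {x | x ∈ X' ∧ W x = w}
  have hY : #Y = 𝔠 := by
    rw [← hX', ← hw]
    exact mk_congr ⟨fun x => ⟨⟨x, x.2.1⟩, x.2.2⟩, fun x => ⟨x.1, x.1.2, x.2⟩, fun _ => rfl,
      fun _ => rfl⟩
  have hunb : ∀ a, ∃ b ∈ τ '' Y, r a b := by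
    intro a
    by_contra! hcon
    have hsub : Y ⊆ {x : ℝ | ∀ b ∈ (φ x).support, b = a ∨ r b a} := fun x hx =>
      hmem_small (hcon _ ⟨x, hx, rfl⟩)
    exact absurd ((mk_le_mk_of_subset hsub).trans_lt (hsmall a)) hY.not_lt
  have hTlt : ∀ y ∈ Y, ∀ x ∈ T, r x (τ y) := by
    intro y hy x hx
    rcases hγ x (Finset.mem_insert_of_mem hx) with rfl | h
    · exact hy.1.2.2
    · exact trans_of r h hy.1.2.2
  have hzY : ∀ y ∈ Y, y ∉ Set.range z := by
    rintro y hy ⟨i, rfl⟩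
    have h1 : τ (z i) ∈ T := Finset.mem_biUnion.2 ⟨i, Finset.mem_univ _, (hτ _ hy.1.2.1).1⟩
    exact irrefl_of r _ (hTlt _ hy _ h1)
  have key : ∀ y ∈ Y, ∀ y' ∈ Y, r (τ y') (τ y) → f (τ y) (τ y') = k →
      ∃ x : Fin (n + 2) → ℝ, Function.Injective x ∧
        (∀ i, x i ∈ X) ∧ g (φ (∑ i, x i)).support = k := by
    intro y hy y' hy' hlt hk
    have hyy' : y ≠ y' := by
      rintro rfl
      exact irrefl_of r _ hlt
    refine ⟨Fin.cons y (Fin.cons y' z), ?_, ?_, ?_⟩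
    · simp only [Fin.cons_injective_iff, Fin.range_cons, Set.mem_insert_iff, not_or]
      exact ⟨⟨hyy', hzY y hy⟩, hzY y' hy', hz⟩
    · refine Fin.cases hy.1.1 (Fin.cases hy'.1.1 fun i => ?_)
      exact (Infinite.natEmbedding X i).2
    · rw [Fin.sum_cons, Fin.sum_cons, map_add, map_add, ← hk]
      have hq := hW y
      have hq' := hW y'
      have hs := hWsep y
      have hs' := hWsep y'
      rw [hy.2] at hq hs
      rw [hy'.2] at hq' hs'
      refine hg _ _ _ (isTopPair_support_add (T := T) (hτ y hy.1.2.1).1 (hτ y' hy'.1.2.1).1 ?_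
        (hτ y hy.1.2.1).2 (hτ y' hy'.1.2.1).2 (hTlt y hy) (hTlt y' hy') hlt hq hq'
        (fun a ha => hs a (Finset.mem_union_left _ ha))
        (fun a ha => hs' a (Finset.mem_union_left _ ha))
        (fun a ha => hs a (Finset.mem_union_right _ ha)))
      rw [map_sum]
      exact Finsupp.support_finsetSum
  obtain ⟨_, ⟨y, hy, rfl⟩, _, ⟨y', hy', rfl⟩, hne, hk, hk'⟩ := hf (τ '' Y) hunb k
  rcases trichotomous_of r (τ y) (τ y') with h | h | h
  · exact key y' hy' y hy h hk'
  · exact absurd h hne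
  · exact key y hy y' hy' h hk
end
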